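/- Let x* be an optimal feasible mechanism of monotone threshold form, i.e., there are κ : [0,1] → [0,1] and τ : [0,1] → [0,∞) with x*(s,y) = κ(s)·1{∏_{k=1}^{n−1} y_k ≥ τ(s)·∏(1−y_k)} for all s ∈ [0,1] and y ∈ [0,1]^(n−1). Then there exists ε > 0 such that for every s ≤ ε, x*(s,y) = 0 for Lebesgue-almost every y ∈ [0,1]^(n−1). Consequently, the efficient mechanism x_eff(s,y) = 1{s·∏_{k=1}^{n−1} y_k ≥ (1−s)·∏(1−y_k)} is not optimal: there exists a feasible mechanism x with V(x) > V(x_eff). -/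

import Mathlib

open MeasureTheory Set Filter

noncomputable section

/-- The unit cube `[0,1]^m` inside `Fin m → ℝ`. -/
def cube (m : ℕ) : Set (Fin m → ℝ) := Set.univ.pi fun _ => Set.Icc (0:ℝ) 1

/-- `w⁺(y) = ∏ y_k · f(y_k)`. -/
def wplus (f : ℝ → ℝ) {m : ℕ} (y : Fin m → ℝ) : ℝ := ∏ k, y k * f (y k)

/-- `w⁻(y) = ∏ (1 - y_k) · f(y_k)`. -/
def wminus (f : ℝ → ℝ) {m : ℕ} (y : Fin m → ℝ) : ℝ := ∏ k, (1 - y k) * f (y k)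

/-- Hypotheses on the signal density `f` with derivative `f'` on `[L,R]`. -/
structure Density (f f' : ℝ → ℝ) (L R : ℝ) : Prop where
  nonneg : ∀ s, 0 ≤ f s
  zero_outside : ∀ s ∉ Set.Icc L R, f s = 0
  pos : ∀ s ∈ Set.Icc L R, 0 < f s
  hderiv : ∀ s ∈ Set.Icc L R, HasDerivWithinAt f (f' s) (Set.Icc L R) s
  cont_deriv : ContinuousOn f' (Set.Icc L R)
  total : (∫ s in L..R, f s) = 1
  mean : (∫ s in L..R, s * f s) = 1 / 2

/-- A mechanism is measurable with values in `[0,1]`. -/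
def IsMechanism {m : ℕ} (x : ℝ → (Fin m → ℝ) → ℝ) : Prop :=
  Measurable (Function.uncurry x) ∧ ∀ s y, x s y ∈ Set.Icc (0:ℝ) 1

/-- `A(t) = ∫_{[0,1]^m} x(t,y) w⁺(y) dy`. -/
def Amap (f : ℝ → ℝ) {m : ℕ} (x : ℝ → (Fin m → ℝ) → ℝ) (t : ℝ) : ℝ :=
  ∫ y in cube m, x t y * wplus f y

/-- `B(t) = ∫_{[0,1]^m} x(t,y) w⁻(y) dy`. -/
def Bmap (f : ℝ → ℝ) {m : ℕ} (x : ℝ → (Fin m → ℝ) → ℝ) (t : ℝ) : ℝ :=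
  ∫ y in cube m, x t y * wminus f y

/-- Interim payoff `U_x(t;s) = 2^m (s A(t) - (1-s) B(t))` (with `m = n-1`). -/
def Upay (f : ℝ → ℝ) {m : ℕ} (x : ℝ → (Fin m → ℝ) → ℝ) (t s : ℝ) : ℝ :=
  2 ^ m * (s * Amap f x t - (1 - s) * Bmap f x t)

/-- Feasibility: mechanism + participation + incentive compatibility on `[L,R]`. -/
def Feasible (f : ℝ → ℝ) (L R : ℝ) {m : ℕ} (x : ℝ → (Fin m → ℝ) → ℝ) : Prop :=
  IsMechanism x ∧ (∀ s ∈ Set.Icc L R, 0 ≤ Upay f x s s) ∧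
    (∀ s ∈ Set.Icc L R, ∀ t ∈ Set.Icc L R, Upay f x t s ≤ Upay f x s s)

/-- The designer's value `V(x)`. -/
def Value (f : ℝ → ℝ) (L R : ℝ) {m : ℕ} (x : ℝ → (Fin m → ℝ) → ℝ) : ℝ :=
  2 ^ m * ∫ s in L..R, (s * Amap f x s + (1 - s) * Bmap f x s) * f s

/-- The first-best utility `Ubar`. -/
def Ubar (f : ℝ → ℝ) (m : ℕ) (s : ℝ) : ℝ :=
  2 ^ m * ∫ y in cube m, max (s * wplus f y - (1 - s) * wminus f y) 0

theorem xmono {A B : ℝ → ℝ}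
    (hic : ∀ s ∈ Icc (0:ℝ) 1, ∀ t ∈ Icc (0:ℝ) 1, s * A t - (1 - s) * B t ≤ s * A s - (1 - s) * B s) :
    MonotoneOn (fun s => A s + B s) (Icc (0:ℝ) 1) := by
  intro s hs t ht hst
  rcases hst.eq_or_lt with rfl | h
  · exact le_rfl
  · have h1 := hic s hs t ht
    have h2 := hic t ht s hs
    show A s + B s ≤ A t + B t
    by_contra hc
    push Not at hc
    nlinarith [mul_pos (sub_pos.2 h) (sub_pos.2 hc)]

theorem ucont {A B : ℝ → ℝ}
    (hic : ∀ s ∈ Icc (0:ℝ) 1, ∀ t ∈ Icc (0:ℝ) 1, s * A t - (1 - s) * B t ≤ s * A s - (1 - s) * B s) :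
    ContinuousOn (fun s => s * A s - (1 - s) * B s) (Icc (0:ℝ) 1) := by
  have hm := xmono hic
  have h0 : (0:ℝ) ∈ Icc (0:ℝ) 1 := by simp
  have h1 : (1:ℝ) ∈ Icc (0:ℝ) 1 := by simp
  set K : ℝ := |A 0 + B 0| + |A 1 + B 1| with hK
  have hX : ∀ s ∈ Icc (0:ℝ) 1, |A s + B s| ≤ K := by
    intro s hs
    have ha := hm h0 hs hs.1
    have hb := hm hs h1 hs.2
    simp only at ha hb
    rw [abs_le]
    constructor
    · have := neg_abs_le (A 0 + B 0)
      have := abs_nonneg (A 1 + B 1)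
      linarith
    · have := le_abs_self (A 1 + B 1)
      have := abs_nonneg (A 0 + B 0)
      linarith
  have hK0 : 0 ≤ K := by positivity
  have key : ∀ s ∈ Icc (0:ℝ) 1, ∀ t ∈ Icc (0:ℝ) 1,
      (s * A s - (1 - s) * B s) - (t * A t - (1 - t) * B t) ≤ K * |s - t| := by
    intro s hs t ht
    have h2 := hic t ht s hs
    have h3 : (A s + B s) * (s - t) ≤ K * |s - t| := by
      calc _ ≤ |(A s + B s) * (s - t)| := le_abs_self _
        _ = |A s + B s| * |s - t| := abs_mul _ _
        _ ≤ _ := mul_le_mul_of_nonneg_right (hX s hs) (abs_nonneg _)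
    nlinarith
  have : LipschitzOnWith (Real.toNNReal K) (fun s => s * A s - (1 - s) * B s) (Icc (0:ℝ) 1) := by
    apply LipschitzOnWith.of_dist_le_mul
    intro s hs t ht
    rw [Real.coe_toNNReal _ hK0, Real.dist_eq, Real.dist_eq, abs_le]
    constructor
    · have := key t ht s hs
      rw [abs_sub_comm] at this
      linarith
    · exact key s hs t ht
  exact this.continuousOn

theorem uderiv {A B : ℝ → ℝ}
    (hic : ∀ s ∈ Icc (0:ℝ) 1, ∀ t ∈ Icc (0:ℝ) 1, s * A t - (1 - s) * B t ≤ s * A s - (1 - s) * B s)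
    {s : ℝ} (hs : s ∈ Ioo (0:ℝ) 1) (hc : ContinuousAt (fun s => A s + B s) s) :
    HasDerivAt (fun s => s * A s - (1 - s) * B s) (A s + B s) s := by
  rw [hasDerivAt_iff_isLittleO, Asymptotics.isLittleO_iff]
  intro c hcpos
  have h1 := Metric.continuousAt_iff'.1 hc c hcpos
  filter_upwards [h1, Icc_mem_nhds hs.1 hs.2] with u hu hu'
  have hs' : s ∈ Icc (0:ℝ) 1 := ⟨hs.1.le, hs.2.le⟩
  have i1 := hic s hs' u hu'
  have i2 := hic u hu' s hs'
  rw [Real.dist_eq] at hu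
  simp only [smul_eq_mul, Real.norm_eq_abs]
  have e : ((A u + B u) - (A s + B s)) * (u - s) ≤ c * |u - s| := by
    calc _ ≤ |((A u + B u) - (A s + B s)) * (u - s)| := le_abs_self _
      _ = |(A u + B u) - (A s + B s)| * |u - s| := abs_mul _ _
      _ ≤ _ := mul_le_mul_of_nonneg_right hu.le (abs_nonneg _)
  have : 0 ≤ c * |u - s| := by positivity
  rw [abs_le]
  constructor <;> nlinarith

def cf (f f' : ℝ → ℝ) (s : ℝ) : ℝ := 3 * (2 * s - 1) * f s - 2 * s * (1 - s) * f' s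

theorem fcont {f f' : ℝ → ℝ} (hf : Density f f' 0 1) : ContinuousOn f (Icc (0:ℝ) 1) :=
  fun s hs => (hf.hderiv s hs).continuousWithinAt

theorem cfcont {f f' : ℝ → ℝ} (hf : Density f f' 0 1) : ContinuousOn (cf f f') (Icc (0:ℝ) 1) := by
  have := fcont hf
  have := hf.cont_deriv
  unfold cf
  fun_prop

theorem parts {f f' A B : ℝ → ℝ} (hf : Density f f' 0 1)
    (hic : ∀ s ∈ Icc (0:ℝ) 1, ∀ t ∈ Icc (0:ℝ) 1, s * A t - (1 - s) * B t ≤ s * A s - (1 - s) * B s) :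
    (∫ s in (0:ℝ)..1, (s * A s + (1 - s) * B s) * f s)
      = ∫ s in (0:ℝ)..1, (s * A s - (1 - s) * B s) * cf f f' s := by
  have hm := xmono hic
  have hU := ucont hic
  have hfc := fcont hf
  have hf'c := hf.cont_deriv
  have hcf := cfcont hf
  set U : ℝ → ℝ := fun s => s * A s - (1 - s) * B s with hUdef
  set X : ℝ → ℝ := fun s => A s + B s with hXdef
  have hI : uIcc (0:ℝ) 1 = Icc 0 1 := uIcc_of_le zero_le_one
  have hXi : IntervalIntegrable X volume 0 1 := by
    apply MonotoneOn.intervalIntegrable; rwa [hI]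
  set G' : ℝ → ℝ := fun s => (2 * (1 - 2 * s) * f s + 2 * s * (1 - s) * f' s) * U s
      + X s * (2 * s * (1 - s) * f s) with hG'
  have hi1 : IntervalIntegrable (fun s => (2 * (1 - 2 * s) * f s + 2 * s * (1 - s) * f' s) * U s) volume 0 1 := by
    apply ContinuousOn.intervalIntegrable; rw [hI]; fun_prop
  have hi2 : IntervalIntegrable (fun s => X s * (2 * s * (1 - s) * f s)) volume 0 1 := by
    apply hXi.mul_continuousOn; rw [hI]; fun_prop
  have hi3 : IntervalIntegrable (fun s => U s * cf f f' s) volume 0 1 := by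
    apply ContinuousOn.intervalIntegrable; rw [hI]; exact hU.mul hcf
  have hG'i : IntervalIntegrable G' volume 0 1 := hi1.add hi2
  have hz : ∫ s in (0:ℝ)..1, G' s = 0 := by
    have := MeasureTheory.integral_eq_of_hasDerivAt_off_countable_of_le
      (fun s => 2 * s * (1 - s) * f s * U s) G' zero_le_one
      hm.countable_not_continuousWithinAt (by fun_prop) ?_ hG'i
    · rw [this]; simp
    · intro s hs
      have hs1 : s ∈ Icc (0:ℝ) 1 := ⟨hs.1.1.le, hs.1.2.le⟩
      have hn : Icc (0:ℝ) 1 ∈ nhds s := Icc_mem_nhds hs.1.1 hs.1.2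
      have hc : ContinuousAt X s := by
        have h2 := hs.2
        by_contra hc
        exact h2 ⟨hs1, fun h => hc (h.continuousAt hn)⟩
      have d1 := uderiv hic hs.1 hc
      have d2 := (hf.hderiv s hs1).hasDerivAt hn
      have d3 : HasDerivAt (fun s : ℝ => 2 * s * (1 - s)) (2 * (1 - 2 * s)) s := by
        have := ((hasDerivAt_id s).const_mul 2).mul ((hasDerivAt_id s).const_sub 1)
        refine this.congr_deriv ?_
        simp only [id]; ring
      refine ((d3.mul d2).mul d1).congr_deriv ?_
      simp only [hG', hXdef, hUdef, Pi.mul_apply]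
      ring
  have : (∫ s in (0:ℝ)..1, (s * A s + (1 - s) * B s) * f s)
      = ∫ s in (0:ℝ)..1, (U s * cf f f' s + G' s) := by
    congr 1
    ext s
    simp only [hG', hXdef, hUdef, cf]
    ring
  rw [this, intervalIntegral.integral_add hi3 hG'i, hz, add_zero]

theorem fmeas {f f' : ℝ → ℝ} (hf : Density f f' 0 1) : Measurable f := by
  classical
  have h : (Icc (0:ℝ) 1).piecewise f (fun _ => 0) = f := by
    ext s
    by_cases hs : s ∈ Icc (0:ℝ) 1
    · simp only [Set.piecewise, hs, if_true]
    · simp only [Set.piecewise, hs, if_false, hf.zero_outside s hs]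
  rw [← h]
  exact (fcont hf).measurable_piecewise continuousOn_const measurableSet_Icc

theorem cube_meas (m : ℕ) : MeasurableSet (cube m) :=
  MeasurableSet.univ_pi fun _ => measurableSet_Icc

theorem cube_vol (m : ℕ) : volume (cube m) = 1 := by
  unfold cube
  rw [volume_pi_pi]; simp

theorem mem_cube {m : ℕ} {y : Fin m → ℝ} (hy : y ∈ cube m) (k : Fin m) : y k ∈ Icc (0:ℝ) 1 :=
  hy k (mem_univ k)

theorem fbdd {f f' : ℝ → ℝ} (hf : Density f f' 0 1) : ∃ C : ℝ, 0 ≤ C ∧ ∀ s, f s ≤ C := by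
  obtain ⟨C, hC⟩ := isCompact_Icc.exists_bound_of_continuousOn (fcont hf)
  refine ⟨max C 0, le_max_right _ _, fun s => ?_⟩
  by_cases hs : s ∈ Icc (0:ℝ) 1
  · exact ((le_abs_self _).trans (hC s hs)).trans (le_max_left _ _)
  · rw [hf.zero_outside s hs]; exact le_max_right _ _

theorem int_gen {f f' : ℝ → ℝ} (hf : Density f f' 0 1) {m : ℕ} {z : (Fin m → ℝ) → ℝ}
    (hz : Measurable z) (hz1 : ∀ y, z y ∈ Icc (0:ℝ) 1) (g : ℝ → ℝ) (hg : Measurable g)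
    (hg1 : ∀ s ∈ Icc (0:ℝ) 1, g s ∈ Icc (0:ℝ) 1) :
    IntegrableOn (fun y => z y * ∏ k, g (y k) * f (y k)) (cube m) := by
  obtain ⟨C, hC0, hC⟩ := fbdd hf
  have hfm := fmeas hf
  apply Measure.integrableOn_of_bounded (M := C ^ m)
  · rw [cube_vol]; simp
  · apply Measurable.aestronglyMeasurable
    fun_prop
  · filter_upwards [ae_restrict_mem (cube_meas m)] with y hy
    have hp : ∀ k, 0 ≤ g (y k) * f (y k) := fun k => mul_nonneg (hg1 _ (mem_cube hy k)).1 (hf.nonneg _)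
    have hP : 0 ≤ ∏ k, g (y k) * f (y k) := Finset.prod_nonneg fun k _ => hp k
    rw [Real.norm_eq_abs, abs_of_nonneg (mul_nonneg (hz1 y).1 hP)]
    calc _ ≤ 1 * ∏ k, g (y k) * f (y k) := mul_le_mul_of_nonneg_right (hz1 y).2 hP
      _ = ∏ k, g (y k) * f (y k) := one_mul _
      _ ≤ ∏ k : Fin m, C := by
        apply Finset.prod_le_prod (fun k _ => hp k)
        intro k _
        calc _ ≤ 1 * f (y k) := mul_le_mul_of_nonneg_right (hg1 _ (mem_cube hy k)).2 (hf.nonneg _)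
          _ ≤ C := by rw [one_mul]; exact hC _
      _ = C ^ m := by simp

theorem pos_gen {f f' : ℝ → ℝ} (hf : Density f f' 0 1) {m : ℕ} {z : (Fin m → ℝ) → ℝ}
    (hz : Measurable z) (hz1 : ∀ y, z y ∈ Icc (0:ℝ) 1) (g : ℝ → ℝ) (hg : Measurable g)
    (hg1 : ∀ s ∈ Icc (0:ℝ) 1, g s ∈ Icc (0:ℝ) 1) :
    0 ≤ ∫ y in cube m, z y * ∏ k, g (y k) * f (y k) := by
  apply setIntegral_nonneg (cube_meas m)
  intro y hy
  exact mul_nonneg (hz1 y).1 (Finset.prod_nonneg fun k _ =>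
    mul_nonneg (hg1 _ (mem_cube hy k)).1 (hf.nonneg _))

theorem zero_gen {f f' : ℝ → ℝ} (hf : Density f f' 0 1) {m : ℕ} {z : (Fin m → ℝ) → ℝ}
    (hz : Measurable z) (hz1 : ∀ y, z y ∈ Icc (0:ℝ) 1) (g : ℝ → ℝ) (hg : Measurable g)
    (hg1 : ∀ s ∈ Icc (0:ℝ) 1, g s ∈ Icc (0:ℝ) 1) (c : ℝ) (hgc : ∀ s, g s = 0 → s = c)
    (h : ∫ y in cube m, z y * ∏ k, g (y k) * f (y k) = 0) :
    ∀ᵐ y ∂(volume.restrict (cube m)), z y = 0 := by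
  have hnn : 0 ≤ᵐ[volume.restrict (cube m)] fun y => z y * ∏ k, g (y k) * f (y k) := by
    filter_upwards [ae_restrict_mem (cube_meas m)] with y hy
    exact mul_nonneg (hz1 y).1 (Finset.prod_nonneg fun k _ =>
      mul_nonneg (hg1 _ (mem_cube hy k)).1 (hf.nonneg _))
  rw [integral_eq_zero_iff_of_nonneg_ae hnn (int_gen hf hz hz1 g hg hg1)] at h
  have hne : ∀ᵐ y ∂(volume.restrict (cube m)), ∀ k, y k ≠ c := by
    apply ae_restrict_of_ae
    rw [ae_all_iff]
    intro k
    rw [volume_pi]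
    exact compl_mem_ae_iff.2 (Measure.pi_hyperplane (fun _ : Fin m => (volume : Measure ℝ)) k c)
  filter_upwards [h, hne, ae_restrict_mem (cube_meas m)] with y hy hyc hym
  rcases mul_eq_zero.1 hy with h | h
  · exact h
  · obtain ⟨k, _, hk⟩ := Finset.prod_eq_zero_iff.1 h
    rcases mul_eq_zero.1 hk with h | h
    · exact absurd (hgc _ h) (hyc k)
    · exact absurd h (hf.pos _ (mem_cube hym k)).ne'

section
variable {f f' : ℝ → ℝ} {m : ℕ} {x : ℝ → (Fin m → ℝ) → ℝ}

theorem xm (hx : IsMechanism x) (t : ℝ) : Measurable (x t) :=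
  hx.1.comp measurable_prodMk_left

theorem A_nonneg (hf : Density f f' 0 1) (hx : IsMechanism x) (t : ℝ) : 0 ≤ Amap f x t :=
  pos_gen hf (xm hx t) (hx.2 t) (fun s => s) measurable_id fun _ h => h

theorem B_nonneg (hf : Density f f' 0 1) (hx : IsMechanism x) (t : ℝ) : 0 ≤ Bmap f x t :=
  pos_gen hf (xm hx t) (hx.2 t) (fun s => 1 - s) (by fun_prop)
    fun s h => ⟨by linarith [h.2], by linarith [h.1]⟩

theorem A_int (hf : Density f f' 0 1) (hx : IsMechanism x) (t : ℝ) :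
    IntegrableOn (fun y => x t y * wplus f y) (cube m) :=
  int_gen hf (xm hx t) (hx.2 t) (fun s => s) measurable_id fun _ h => h

theorem B_int (hf : Density f f' 0 1) (hx : IsMechanism x) (t : ℝ) :
    IntegrableOn (fun y => x t y * wminus f y) (cube m) :=
  int_gen hf (xm hx t) (hx.2 t) (fun s => 1 - s) (by fun_prop)
    fun s h => ⟨by linarith [h.2], by linarith [h.1]⟩

theorem A_zero (hf : Density f f' 0 1) (hx : IsMechanism x) (t : ℝ) (h : Amap f x t = 0) :
    ∀ᵐ y ∂(volume.restrict (cube m)), x t y = 0 :=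
  zero_gen hf (xm hx t) (hx.2 t) (fun s => s) measurable_id (fun _ h => h) 0 (fun _ h => h) h

theorem B_zero (hf : Density f f' 0 1) (hx : IsMechanism x) (t : ℝ) (h : Bmap f x t = 0) :
    ∀ᵐ y ∂(volume.restrict (cube m)), x t y = 0 :=
  zero_gen hf (xm hx t) (hx.2 t) (fun s => 1 - s) (by fun_prop)
    (fun s h => ⟨by linarith [h.2], by linarith [h.1]⟩) 1 (fun s h => by linarith) h

theorem ic_of (hx : Feasible f 0 1 x) : ∀ s ∈ Icc (0:ℝ) 1, ∀ t ∈ Icc (0:ℝ) 1,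
    s * Amap f x t - (1 - s) * Bmap f x t ≤ s * Amap f x s - (1 - s) * Bmap f x s := by
  intro s hs t ht
  have := hx.2.2 s hs t ht
  unfold Upay at this
  exact le_of_mul_le_mul_left this (by positivity)

theorem pc_of (hx : Feasible f 0 1 x) : ∀ s ∈ Icc (0:ℝ) 1,
    0 ≤ s * Amap f x s - (1 - s) * Bmap f x s := by
  intro s hs
  have := hx.2.1 s hs
  unfold Upay at this
  exact nonneg_of_mul_nonneg_right this (by positivity)

theorem feas_of (hm : IsMechanism x)
    (hp : ∀ s ∈ Icc (0:ℝ) 1, 0 ≤ s * Amap f x s - (1 - s) * Bmap f x s)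
    (hic : ∀ s ∈ Icc (0:ℝ) 1, ∀ t ∈ Icc (0:ℝ) 1,
    s * Amap f x t - (1 - s) * Bmap f x t ≤ s * Amap f x s - (1 - s) * Bmap f x s) :
    Feasible f 0 1 x :=
  ⟨hm, fun s hs => mul_nonneg (by positivity) (hp s hs),
    fun s hs t ht => mul_le_mul_of_nonneg_left (hic s hs t ht) (by positivity)⟩

theorem value_eq (hf : Density f f' 0 1) (hx : Feasible f 0 1 x) :
    Value f 0 1 x = 2 ^ m * ∫ s in (0:ℝ)..1,
      (s * Amap f x s - (1 - s) * Bmap f x s) * cf f f' s := by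
  unfold Value
  rw [parts hf (ic_of hx)]

theorem improve (hf : Density f f' 0 1) (hx : Feasible f 0 1 x)
    (hpos : ∀ s ∈ Ioc (0:ℝ) 1, 0 < Amap f x s + Bmap f x s) :
    ∃ x' : ℝ → (Fin m → ℝ) → ℝ, Feasible f 0 1 x' ∧ Value f 0 1 x < Value f 0 1 x' := by
  have hA := A_nonneg hf hx.1
  have hB := B_nonneg hf hx.1
  have hic := ic_of hx
  have hpc := pc_of hx
  have hmono := xmono hic
  -- choose s₁
  have hc0 : cf f f' 0 < 0 := by
    have := hf.pos 0 (by simp)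
    unfold cf; nlinarith
  have hev := (cfcont hf 0 (by simp)).eventually (gt_mem_nhds hc0)
  obtain ⟨δ, hδ, hδ'⟩ := Metric.mem_nhdsWithin_iff.1 hev
  obtain ⟨s₁, h0s, hs1, hsδ⟩ : ∃ s₁ : ℝ, 0 < s₁ ∧ s₁ ≤ 1 ∧ s₁ < δ :=
    ⟨min (δ/2) 1, by positivity, min_le_right _ _, by
      have := min_le_left (δ/2) 1; linarith⟩
  have hcneg : ∀ s ∈ Icc (0:ℝ) s₁, cf f f' s < 0 := by
    intro s hs
    apply hδ' ⟨_, hs.1, hs.2.trans hs1⟩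
    rw [Metric.mem_ball, Real.dist_eq, sub_zero, abs_of_nonneg hs.1]
    linarith [hs.2]
  have hs₁ : s₁ ∈ Icc (0:ℝ) 1 := ⟨h0s.le, hs1⟩
  have hX1 := hpos s₁ ⟨h0s, hs1⟩
  have hB1 : 0 < Bmap f x s₁ := by
    rcases (hB s₁).eq_or_lt with h | h
    · exfalso
      have hz := B_zero hf hx.1 s₁ h.symm
      have : Amap f x s₁ = 0 := by
        unfold Amap
        apply integral_eq_zero_of_ae
        filter_upwards [hz] with y hy
        simp [hy]
      linarith
    · exact h
  set A₁ := Amap f x s₁ with hA₁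
  set B₁ := Bmap f x s₁ with hB₁
  set ε := B₁ / (A₁ + B₁) with hε
  have hε0 : 0 < ε := by positivity
  have hεX : ε * (A₁ + B₁) = B₁ := by rw [hε]; field_simp
  have hεs : ε ≤ s₁ := by
    rw [hε, div_le_iff₀ hX1]
    linarith [hpc s₁ hs₁]
  let x' : ℝ → (Fin m → ℝ) → ℝ := fun s y => if s < ε then 0 else x (max s s₁) y
  have hx'm : IsMechanism x' := by
    constructor
    · have : Function.uncurry x' = fun p : ℝ × (Fin m → ℝ) =>
          if p.1 < ε then 0 else Function.uncurry x (max p.1 s₁, p.2) := by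
        ext p; rfl
      rw [this]
      apply Measurable.ite (measurableSet_lt measurable_fst measurable_const) measurable_const
      exact hx.1.1.comp (by fun_prop)
    · intro s y
      show (if s < ε then 0 else x (max s s₁) y) ∈ Icc (0:ℝ) 1
      split_ifs
      · simp
      · exact hx.1.2 _ _
  have hA'0 : ∀ t, t < ε → Amap f x' t = 0 := by
    intro t ht; simp [Amap, x', ht]
  have hB'0 : ∀ t, t < ε → Bmap f x' t = 0 := by
    intro t ht; simp [Bmap, x', ht]
  have hA'1 : ∀ t, ε ≤ t → Amap f x' t = Amap f x (max t s₁) := by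
    intro t ht; simp [Amap, x', not_lt.2 ht]
  have hB'1 : ∀ t, ε ≤ t → Bmap f x' t = Bmap f x (max t s₁) := by
    intro t ht; simp [Bmap, x', not_lt.2 ht]
  -- key deviation inequality
  have hdev : ∀ s, s ≤ s₁ → ∀ t ∈ Icc (0:ℝ) 1, s₁ ≤ t →
      s * Amap f x t - (1 - s) * Bmap f x t ≤ s * A₁ - (1 - s) * B₁ := by
    intro s hs t ht hst
    have h1 := hic s₁ hs₁ t ht
    have h2 := hmono hs₁ ht hst
    simp only at h2
    nlinarith [mul_nonneg (sub_nonneg.2 hs) (sub_nonneg.2 h2)]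
  have hpc' : ∀ s ∈ Icc (0:ℝ) 1, 0 ≤ s * Amap f x' s - (1 - s) * Bmap f x' s := by
    intro s hs
    rcases lt_or_ge s ε with h | h
    · simp [hA'0 s h, hB'0 s h]
    · rw [hA'1 s h, hB'1 s h]
      rcases le_total s s₁ with h' | h'
      · rw [max_eq_right h']
        nlinarith
      · rw [max_eq_left h']; exact hpc s hs
  have hic' : ∀ s ∈ Icc (0:ℝ) 1, ∀ t ∈ Icc (0:ℝ) 1,
      s * Amap f x' t - (1 - s) * Bmap f x' t ≤ s * Amap f x' s - (1 - s) * Bmap f x' s := by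
    intro s hs t ht
    rcases lt_or_ge t ε with h | h
    · rw [hA'0 t h, hB'0 t h]
      simpa using hpc' s hs
    · have hm' : max t s₁ ∈ Icc (0:ℝ) 1 := ⟨ht.1.trans (le_max_left _ _), max_le ht.2 hs1⟩
      rw [hA'1 t h, hB'1 t h]
      rcases le_total s s₁ with h' | h'
      · refine (hdev s h' _ hm' (le_max_right _ _)).trans ?_
        rcases lt_or_ge s ε with h2 | h2
        · rw [hA'0 s h2, hB'0 s h2]
          nlinarith
        · rw [hA'1 s h2, hB'1 s h2, max_eq_right h']
      · rw [hA'1 s (hεs.trans h'), hB'1 s (hεs.trans h'), max_eq_left h']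
        exact hic s hs _ hm'
  have hx' : Feasible f 0 1 x' := feas_of hx'm hpc' hic'
  refine ⟨x', hx', ?_⟩
  rw [value_eq hf hx, value_eq hf hx']
  apply mul_lt_mul_of_pos_left _ (by positivity)
  have hI : uIcc (0:ℝ) 1 = Icc 0 1 := uIcc_of_le zero_le_one
  have c1 : ContinuousOn (fun s => (s * Amap f x s - (1 - s) * Bmap f x s) * cf f f' s) (Icc (0:ℝ) 1) :=
    (ucont hic).mul (cfcont hf)
  have c2 : ContinuousOn (fun s => (s * Amap f x' s - (1 - s) * Bmap f x' s) * cf f f' s) (Icc (0:ℝ) 1) :=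
    (ucont hic').mul (cfcont hf)
  have hUpos : ∀ s ∈ Ioc (0:ℝ) 1, 0 < s * Amap f x s - (1 - s) * Bmap f x s := by
    intro s hs
    have ht : s / 2 ∈ Icc (0:ℝ) 1 := ⟨by linarith [hs.1], by linarith [hs.1, hs.2]⟩
    have h1 := hic s ⟨hs.1.le, hs.2⟩ (s/2) ht
    have h2 := hpc (s/2) ht
    have h3 := hpos (s/2) ⟨by linarith [hs.1], by linarith [hs.1, hs.2]⟩
    nlinarith [mul_pos hs.1 h3]
  apply intervalIntegral.integral_lt_integral_of_continuousOn_of_le_of_exists_lt zero_lt_one c1 c2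
  · intro s hs
    have hs' : s ∈ Icc (0:ℝ) 1 := ⟨hs.1.le, hs.2⟩
    rcases le_total s s₁ with h' | h'
    · apply mul_le_mul_of_nonpos_right _ (hcneg s ⟨hs.1.le, h'⟩).le
      rcases lt_or_ge s ε with h2 | h2
      · rw [hA'0 s h2, hB'0 s h2]
        simpa using hpc s hs'
      · rw [hA'1 s h2, hB'1 s h2, max_eq_right h']
        exact hic s hs' s₁ hs₁
    · rw [hA'1 s (hεs.trans h'), hB'1 s (hεs.trans h'), max_eq_left h']
  · refine ⟨ε / 2, ⟨by positivity, by linarith⟩, ?_⟩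
    have h2 : ε / 2 < ε := by linarith
    rw [hA'0 _ h2, hB'0 _ h2]
    have h3 := hcneg (ε / 2) ⟨by positivity, by linarith⟩
    have h4 := hUpos (ε / 2) ⟨by positivity, by linarith⟩
    simp only [mul_zero, sub_zero, zero_mul]
    exact mul_neg_of_pos_of_neg h4 h3

end

theorem eff_part {f f' : ℝ → ℝ} (hf : Density f f' 0 1) {m : ℕ} (hm : m ≠ 0) :
    ∃ x : ℝ → (Fin m → ℝ) → ℝ, Feasible f 0 1 x ∧
      Value f 0 1 (fun s (y : Fin m → ℝ) =>
        if (1 - s) * ∏ k, (1 - y k) ≤ s * ∏ k, y k then 1 else 0) < Value f 0 1 x := by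
  set x : ℝ → (Fin m → ℝ) → ℝ := fun s (y : Fin m → ℝ) =>
        if (1 - s) * ∏ k, (1 - y k) ≤ s * ∏ k, y k then 1 else 0 with hxdef
  have hx : IsMechanism x := by
    constructor
    · have : Function.uncurry x = fun p : ℝ × (Fin m → ℝ) =>
          if (1 - p.1) * ∏ k, (1 - p.2 k) ≤ p.1 * ∏ k, p.2 k then 1 else 0 := by
        ext p; rfl
      rw [this]
      apply Measurable.ite (measurableSet_le (by fun_prop) (by fun_prop)) measurable_const measurable_const
    · intro s y
      simp only [hxdef]
      split_ifs <;> simp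
  have hrep : ∀ s t : ℝ, s * Amap f x t - (1 - s) * Bmap f x t =
      ∫ y in cube m, x t y * ((s * ∏ k, y k - (1 - s) * ∏ k, (1 - y k)) * ∏ k, f (y k)) := by
    intro s t
    unfold Amap Bmap
    rw [← integral_const_mul, ← integral_const_mul, ← integral_sub ((A_int hf hx t).const_mul s)
      ((B_int hf hx t).const_mul (1 - s))]
    congr 1
    ext y
    simp only [wplus, wminus, Finset.prod_mul_distrib]
    ring
  have hint : ∀ s t : ℝ, IntegrableOn (fun y => x t y * ((s * ∏ k, y k - (1 - s) * ∏ k, (1 - y k)) * ∏ k, f (y k))) (cube m) := by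
    intro s t
    refine (((A_int hf hx t).const_mul s).sub ((B_int hf hx t).const_mul (1 - s))).congr ?_
    refine Eventually.of_forall fun y => ?_
    simp only [wplus, wminus, Finset.prod_mul_distrib, Pi.sub_apply]
    ring
  have hF : ∀ y : Fin m → ℝ, 0 ≤ ∏ k, f (y k) := fun y => Finset.prod_nonneg fun k _ => hf.nonneg _
  have hfe : Feasible f 0 1 x := by
    apply feas_of hx
    · intro s hs
      rw [hrep]
      apply setIntegral_nonneg (cube_meas m)
      intro y hy
      simp only [hxdef]
      split_ifs with h
      · rw [one_mul]; exact mul_nonneg (sub_nonneg.2 h) (hF y)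
      · simp
    · intro s hs t ht
      rw [hrep, hrep]
      apply setIntegral_mono_on (hint s t) (hint s s) (cube_meas m)
      intro y hy
      rw [← mul_assoc, ← mul_assoc]
      apply mul_le_mul_of_nonneg_right _ (hF y)
      simp only [hxdef]
      split_ifs <;> linarith
  apply improve hf hfe
  intro s hs
  have hA := A_nonneg hf hx s
  have hB := B_nonneg hf hx s
  rcases hA.eq_or_lt with h | h
  swap
  · linarith
  exfalso
  have hz := A_zero hf hx s h.symm
  rw [ae_restrict_iff' (cube_meas m)] at hz
  have hbox : volume (Icc (fun _ : Fin m => 1 - s / 2) (fun _ => (1:ℝ))) = 0 := by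
    refine measure_mono_null ?_ (ae_iff.1 hz)
    intro y hy hc
    have hy1 : ∀ k, 1 - s / 2 ≤ y k := fun k => hy.1 k
    have hy2 : ∀ k, y k ≤ 1 := fun k => hy.2 k
    have hyc : y ∈ cube m := fun k _ => ⟨by linarith [hy1 k, hs.2], hy2 k⟩
    have h0 : x s y = 0 := hc hyc
    have h1 : ∏ k, (1 - y k) ≤ (s/2) ^ m := by
      calc _ ≤ ∏ k : Fin m, (s/2) := Finset.prod_le_prod (fun k _ => by linarith [hy2 k])
            (fun k _ => by linarith [hy1 k])
        _ = _ := by rw [Finset.prod_const, Finset.card_univ, Fintype.card_fin]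
    have h1' : 0 ≤ ∏ k, (1 - y k) := Finset.prod_nonneg fun k _ => by linarith [hy2 k]
    have h2 : (1/2:ℝ) ^ m ≤ ∏ k, y k := by
      calc (1/2:ℝ) ^ m = ∏ k : Fin m, (1/2:ℝ) := by simp
        _ ≤ _ := Finset.prod_le_prod (fun k _ => by norm_num)
            (fun k _ => by linarith [hy1 k, hs.2])
    have h3 : (s/2) ^ m ≤ s * (1/2) ^ m := by
      have : s ^ m ≤ s := pow_le_of_le_one hs.1.le hs.2 hm
      calc (s/2) ^ m = s ^ m * (1/2) ^ m := by rw [← mul_pow]; ring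
        _ ≤ _ := mul_le_mul_of_nonneg_right this (by positivity)
    have h4 : (1 - s) * ∏ k, (1 - y k) ≤ s * ∏ k, y k := by
      have := mul_le_mul_of_nonneg_left h2 hs.1.le
      nlinarith [mul_nonneg hs.1.le h1']
    simp only [hxdef, h4, if_true] at h0
    exact one_ne_zero h0
  rw [Real.volume_Icc_pi] at hbox
  have := Finset.prod_eq_zero_iff.1 hbox
  obtain ⟨k, _, hk⟩ := this
  rw [ENNReal.ofReal_eq_zero] at hk
  linarith [hs.1]

theorem stmt2 (n : ℕ) (hn : 2 ≤ n) (f f' : ℝ → ℝ) (hf : Density f f' 0 1)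
    (xstar : ℝ → (Fin (n - 1) → ℝ) → ℝ) (κ τ : ℝ → ℝ)
    (hκ : ∀ s ∈ Set.Icc (0:ℝ) 1, κ s ∈ Set.Icc (0:ℝ) 1)
    (hτ : ∀ s ∈ Set.Icc (0:ℝ) 1, 0 ≤ τ s)
    (hform : ∀ s ∈ Set.Icc (0:ℝ) 1, ∀ y ∈ cube (n - 1),
      xstar s y = if τ s * ∏ k, (1 - y k) ≤ ∏ k, y k then κ s else 0)
    (hfeas : Feasible f 0 1 xstar)
    (hopt : ∀ x : ℝ → (Fin (n - 1) → ℝ) → ℝ, Feasible f 0 1 x →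
      Value f 0 1 x ≤ Value f 0 1 xstar) :
    (∃ ε > (0:ℝ), ∀ s ∈ Set.Icc (0:ℝ) ε,
      ∀ᵐ y ∂(volume.restrict (cube (n - 1))), xstar s y = 0) ∧
    (∃ x : ℝ → (Fin (n - 1) → ℝ) → ℝ, Feasible f 0 1 x ∧
      Value f 0 1 (fun s (y : Fin (n - 1) → ℝ) =>
        if (1 - s) * ∏ k, (1 - y k) ≤ s * ∏ k, y k then 1 else 0) < Value f 0 1 x) := by
  have hm : n - 1 ≠ 0 := by omega
  refine ⟨?_, eff_part hf hm⟩
  by_contra hcon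
  push Not at hcon
  have hic := ic_of hfeas
  have hmono := xmono hic
  have hpos : ∀ s ∈ Ioc (0:ℝ) 1, 0 < Amap f xstar s + Bmap f xstar s := by
    intro s hs
    obtain ⟨t, ht, hnz⟩ := hcon s hs.1
    have hA := A_nonneg hf hfeas.1 t
    have hB := B_nonneg hf hfeas.1 t
    have hle := hmono (a := t) ⟨ht.1, ht.2.trans hs.2⟩ ⟨hs.1.le, hs.2⟩ ht.2
    simp only at hle
    rcases hA.eq_or_lt with h | h
    · exact absurd (A_zero hf hfeas.1 t h.symm) (by simpa using hnz)
    · linarith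
  obtain ⟨x', hx', hlt⟩ := improve hf hfeas hpos
  exact absurd (hopt x' hx') (not_le.2 hlt)
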